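/- Let PN be a Petri net, Init a nonempty set of markings, and H an Init-home space such that the subgraph of the reachability graph induced by H ∩ RS(PN,Init) (vertices H ∩ RS(PN,Init), with an edge from q to t'(q) whenever t' ∈ T is enabled at q and both q and t'(q) lie in H ∩ RS(PN,Init)) is strongly connected. Then a transition t is live in ⟨PN,Init⟩ if and only if there exist a marking h ∈ H ∩ RS(PN,Init) and a firing sequence σ ∈ T* such that the sequence σ followed by t is fireable from h. -/

import Mathlib

namespace PetriNetFormal

variable {P T : Type*}

/-- The marking obtained by firing transition `t` at marking `q`. -/
def fire (Pre Post : P → T → ℕ) (t : T) (q : P → ℕ) : P → ℕ :=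
  fun p => q p - Pre p t + Post p t

/-- Transition `t` is enabled at marking `q`. -/
def enabled (Pre : P → T → ℕ) (q : P → ℕ) (t : T) : Prop :=
  ∀ p, Pre p t ≤ q p

/-- One firing step between markings. -/
def step (Pre Post : P → T → ℕ) (q q' : P → ℕ) : Prop :=
  ∃ t, enabled Pre q t ∧ q' = fire Pre Post t q

/-- Reachability: `q'` is obtained from `q` by firing a finite sequence of transitions. -/
def reach (Pre Post : P → T → ℕ) : (P → ℕ) → (P → ℕ) → Prop :=
  Relation.ReflTransGen (step Pre Post)

/-- The reachability set from a set `Init` of initial markings. -/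
def RS (Pre Post : P → T → ℕ) (Init : Set (P → ℕ)) : Set (P → ℕ) :=
  {q | ∃ a ∈ Init, reach Pre Post a q}

/-- `H` is an `Init`-home space. -/
def homeSpace (Pre Post : P → T → ℕ) (Init H : Set (P → ℕ)) : Prop :=
  ∀ q ∈ RS Pre Post Init, ∃ h ∈ H, reach Pre Post q h

/-- `s` is an `Init`-home state. -/
def homeState (Pre Post : P → T → ℕ) (Init : Set (P → ℕ)) (s : P → ℕ) : Prop :=
  homeSpace Pre Post Init {s}

/-- `S` is a strongly connected component sink of `RG(PN,Init)`: an equivalence class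
of the mutual-reachability relation on `RS(PN,Init)` that is closed under reachability. -/
def sccSink (Pre Post : P → T → ℕ) (Init : Set (P → ℕ)) (S : Set (P → ℕ)) : Prop :=
  (∃ x ∈ RS Pre Post Init,
    S = {y ∈ RS Pre Post Init | reach Pre Post x y ∧ reach Pre Post y x}) ∧
  (∀ y ∈ S, ∀ z, reach Pre Post y z → z ∈ S)

/-- Transition `t` is live in `⟨PN, Init⟩`. -/
def live (Pre Post : P → T → ℕ) (Init : Set (P → ℕ)) (t : T) : Prop :=
  ∀ q ∈ RS Pre Post Init, ∃ q', reach Pre Post q q' ∧ enabled Pre q' t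

/-- One firing step restricted to the vertex set `V` (induced subgraph edges). -/
def stepIn (Pre Post : P → T → ℕ) (V : Set (P → ℕ)) (q q' : P → ℕ) : Prop :=
  q ∈ V ∧ q' ∈ V ∧ step Pre Post q q'

/-- Markings reachable from the reachability set stay in it. -/
theorem RS.of_reach {Pre Post : P → T → ℕ} {Init : Set (P → ℕ)} {q q' : P → ℕ}
    (hq : q ∈ RS Pre Post Init) (h : reach Pre Post q q') : q' ∈ RS Pre Post Init :=
  let ⟨a, ha, haq⟩ := hq
  ⟨a, ha, Relation.ReflTransGen.trans haq h⟩

/-- Every reachable marking can reach a home-space marking that is itself reachable. -/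
theorem homeSpace.exists_reach {Pre Post : P → T → ℕ} {Init H : Set (P → ℕ)}
    (hHS : homeSpace Pre Post Init H) {q : P → ℕ} (hq : q ∈ RS Pre Post Init) :
    ∃ h ∈ H ∩ RS Pre Post Init, reach Pre Post q h :=
  let ⟨h, hH, hqh⟩ := hHS q hq
  ⟨h, ⟨hH, RS.of_reach hq hqh⟩, hqh⟩

/-- A path in an induced subgraph is a path in the reachability graph. -/
theorem reach_of_reflTransGen_stepIn {Pre Post : P → T → ℕ} {V : Set (P → ℕ)} {q q' : P → ℕ}
    (h : Relation.ReflTransGen (stepIn Pre Post V) q q') : reach Pre Post q q' :=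
  Relation.ReflTransGen.mono (fun _ _ hs => hs.2.2) _ _ h

/-- if `H` is an `Init`-home space whose intersection with `RS(PN,Init)`
induces a strongly connected subgraph of the reachability graph, then a transition `t`
is live iff the sequence `σt` is fireable from some `h ∈ H ∩ RS(PN,Init)`, i.e. some
marking reachable from `h` enables `t`. -/
theorem live_iff_enabled_from_strongly_connected_home_space
    (Pre Post : P → T → ℕ) (Init : Set (P → ℕ)) (hInit : Init.Nonempty)
    (H : Set (P → ℕ)) (hHS : homeSpace Pre Post Init H)
    (hconn : ∀ x ∈ H ∩ RS Pre Post Init, ∀ y ∈ H ∩ RS Pre Post Init,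
      Relation.ReflTransGen (stepIn Pre Post (H ∩ RS Pre Post Init)) x y)
    (t : T) :
    live Pre Post Init t ↔
      ∃ h ∈ H ∩ RS Pre Post Init,
        ∃ q', reach Pre Post h q' ∧ enabled Pre q' t := by
  constructor
  · intro hlive
    obtain ⟨a, ha⟩ := hInit
    obtain ⟨h, hh, -⟩ := hHS.exists_reach ⟨a, ha, Relation.ReflTransGen.refl⟩
    exact ⟨h, hh, hlive h hh.2⟩
  · rintro ⟨h, hh, q', hq', ht⟩ q hq
    obtain ⟨x, hx, hqx⟩ := hHS.exists_reach hq
    have hxh : reach Pre Post x h := reach_of_reflTransGen_stepIn (hconn x hx h hh)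
    exact ⟨q', Relation.ReflTransGen.trans hqx (Relation.ReflTransGen.trans hxh hq'), ht⟩

end PetriNetFormal
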